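/- Let k ≥ 2 be an integer and let G be a connected simple graph with an independent set of three pairwise nonadjacent vertices, and suppose G has no dominating tree with at most k leaves. Then t_{k+1} ≥ σ_3 + 2k − 3, where σ_3 is the minimum of d(x)+d(y)+d(z) over independent triples {x,y,z} and t_{k+1} is the maximum order of a subgraph of G that is a tree with at most k+1 leaves. -/

import Mathlib

open SimpleGraph

/-- The degree of a vertex: the cardinality of its neighborhood. -/
noncomputable def deg {V : Type*} (G : SimpleGraph V) (x : V) : ℕ :=
  (G.neighborSet x).ncard

/-- The number of leaves (vertices of degree 1) of a subgraph. -/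
noncomputable def leafCount {V : Type*} {G : SimpleGraph V} (H : G.Subgraph) : ℕ :=
  {v : H.verts | (H.coe.neighborSet v).ncard = 1}.ncard

/-- `H` is a tree with at most `k` leaves (a `k`-ended tree). -/
def IsEndedTree {V : Type*} {G : SimpleGraph V} (H : G.Subgraph) (k : ℕ) : Prop :=
  H.coe.IsTree ∧ leafCount H ≤ k

/-- `t_k`: the maximum order of a subgraph of `G` that is a tree with at most `k` leaves. -/
noncomputable def treeOrd {V : Type*} (G : SimpleGraph V) (k : ℕ) : ℕ :=
  sSup {m | ∃ H : G.Subgraph, IsEndedTree H k ∧ H.verts.ncard = m}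

/-- The number of vertices of a longest path in `G`. -/
noncomputable def pathOrd {V : Type*} (G : SimpleGraph V) : ℕ :=
  sSup {m | ∃ (u v : V) (p : G.Walk u v), p.IsPath ∧ p.support.length = m}

/-- `s` is an independent set of vertices of `G`. -/
def IsIndep {V : Type*} (G : SimpleGraph V) (s : Set V) : Prop :=
  s.Pairwise fun a b => ¬ G.Adj a b

/-- `σ₃`: the minimum degree sum over independent triples of vertices. -/
noncomputable def sigma3 {V : Type*} (G : SimpleGraph V) : ℕ :=
  sInf {s | ∃ x y z : V, x ≠ y ∧ x ≠ z ∧ y ≠ z ∧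
    ¬G.Adj x y ∧ ¬G.Adj x z ∧ ¬G.Adj y z ∧ s = deg G x + deg G y + deg G z}

open Classical in
/-- nontrivial tree on vertex set `S` with leaves inside `L` -/
def ET {V : Type*} (G : SimpleGraph V) (S : Set V) (L : Finset V) : Prop :=
  ∃ H : G.Subgraph, H.verts = S ∧ H.Connected ∧ H.spanningCoe.IsAcyclic ∧
    (∀ v ∈ S, ∃ u, H.Adj v u) ∧ ∀ v, (H.neighborSet v).ncard = 1 → v ∈ L

lemma ET.mono {V : Type*} {G : SimpleGraph V} {S : Set V} {L L' : Finset V}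
    (h : ET G S L) (hL : L ⊆ L') : ET G S L' := by
  obtain ⟨H, h1, h2, h3, h4, h5⟩ := h
  exact ⟨H, h1, h2, h3, h4, fun v hv => hL (h5 v hv)⟩

open Classical in
lemma ET.edge {V : Type*} {G : SimpleGraph V} {a b : V} (h : G.Adj a b) :
    ET G {a, b} {a, b} := by
  refine ⟨G.subgraphOfAdj h, rfl, Subgraph.subgraphOfAdj_connected h, ?_, ?_, ?_⟩
  · have : (G.subgraphOfAdj h).spanningCoe = ⊥ ⊔ SimpleGraph.edge a b := by
      ext x y
      simp only [Subgraph.spanningCoe_adj, subgraphOfAdj_adj, sup_adj, bot_adj, edge_adj, Sym2.eq_iff]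
      have := h.ne
      grind
    rw [this]
    apply IsAcyclic.sup_edge_of_not_reachable
    · rw [reachable_bot]; exact h.ne
    · exact isAcyclic_bot
  · rintro v (rfl | rfl)
    · exact ⟨b, by simp⟩
    · exact ⟨a, by simp⟩
  · intro v hv
    obtain ⟨u, hu⟩ := Set.nonempty_of_ncard_ne_zero (by omega : ((G.subgraphOfAdj h).neighborSet v).ncard ≠ 0)
    have := (show (G.subgraphOfAdj h).Adj v u from hu).fst_mem
    simpa using this

open Classical in
lemma ET.attach {V : Type*} [Finite V] {G : SimpleGraph V} {S : Set V} {L : Finset V} {v w : V}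
    (h : ET G S L) (hv : v ∈ S) (hw : w ∉ S) (hvw : G.Adj v w) :
    ET G (insert w S) (insert w (L.erase v)) := by
  obtain ⟨H, rfl, h2, h3, h4, h5⟩ := h
  have hnw : ∀ u, ¬ H.Adj w u := fun u hu => hw hu.fst_mem
  have hnw' : ∀ u, ¬ H.Adj u w := fun u hu => hw hu.snd_mem
  have hne := hvw.ne
  refine ⟨H ⊔ G.subgraphOfAdj hvw, ?_, ?_, ?_, ?_, ?_⟩
  · ext x; simp; grind
  · apply Subgraph.connected_sup h2.preconnected (Subgraph.subgraphOfAdj_connected hvw).preconnected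
    exact ⟨v, hv, by simp⟩
  · have : (H ⊔ G.subgraphOfAdj hvw).spanningCoe = H.spanningCoe ⊔ SimpleGraph.edge v w := by
      ext x y
      simp only [Subgraph.spanningCoe_adj, Subgraph.sup_adj, subgraphOfAdj_adj, sup_adj, edge_adj, Sym2.eq_iff]
      grind
    rw [this]
    apply IsAcyclic.sup_edge_of_not_reachable _ h3
    intro hr
    obtain ⟨p⟩ := hr.symm
    cases p with
    | nil => exact hne rfl
    | cons h' _ => exact hnw _ h'
  · rintro u (rfl | hu)
    · exact ⟨v, by simp⟩
    · obtain ⟨t, ht⟩ := h4 u hu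
      exact ⟨t, Or.inl ht⟩
  · intro u hu
    by_cases huw : u = w
    · simp [huw]
    by_cases huv : u = v
    · exfalso
      subst huv
      obtain ⟨t, ht⟩ := h4 u hv
      obtain ⟨s, hs⟩ := Set.ncard_eq_one.1 hu
      have e1 : t ∈ (H ⊔ G.subgraphOfAdj hvw).neighborSet u := Or.inl ht
      have e2 : w ∈ (H ⊔ G.subgraphOfAdj hvw).neighborSet u := Or.inr (by simp)
      rw [hs] at e1 e2
      have : t = w := by rw [e1, e2]
      exact hnw' u (this ▸ ht)
    · have : (H ⊔ G.subgraphOfAdj hvw).neighborSet u = H.neighborSet u := by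
        ext x
        simp only [Subgraph.mem_neighborSet, Subgraph.sup_adj, subgraphOfAdj_adj, Sym2.eq_iff]
        grind
      rw [this] at hu
      simp [huw, huv, h5 u hu]

open Classical in
lemma ET.ext {V : Type*} [Finite V] {G : SimpleGraph V} (l : List V) : ∀ {S : Set V} {L : Finset V} {v : V},
    ET G S (insert v L) → v ∈ S → (v :: l).IsChain G.Adj → l.Nodup → (∀ u ∈ l, u ∉ S) →
    ∃ t, ET G (S ∪ {u | u ∈ l}) (insert t L) := by
  induction l with
  | nil => intro S L v h _ _ _ _; exact ⟨v, by simpa using h⟩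
  | cons a l ih =>
    intro S L v h hv hc hn hd
    rw [List.isChain_cons_cons] at hc
    have hn' := List.nodup_cons.1 hn
    have h1 : ET G (insert a S) (insert a L) :=
      (h.attach hv (hd a (by simp)) hc.1).mono (by intro x; simp; tauto)
    obtain ⟨t, ht⟩ := ih h1 (by simp) hc.2 hn'.2 (by
      intro u hu
      have := hd u (by simp [hu])
      simp only [Set.mem_insert_iff, not_or]
      exact ⟨by rintro rfl; exact hn'.1 hu, this⟩)
    refine ⟨t, ?_⟩
    convert ht using 1
    ext x; simp; tauto

lemma ET.ended {V : Type*} [Finite V] {G : SimpleGraph V} {S : Set V} {L : Finset V} {k : ℕ}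
    (h : ET G S L) (hk : L.card ≤ k) : ∃ H : G.Subgraph, IsEndedTree H k ∧ H.verts = S := by
  obtain ⟨H, h1, h2, h3, h4, h5⟩ := h
  refine ⟨H, ⟨⟨h2.coe, ?_⟩, ?_⟩, h1⟩
  · exact h3.comap (G' := H.spanningCoe) ⟨Subtype.val, fun h => h⟩ Subtype.val_injective
  · refine le_trans ?_ hk
    unfold leafCount
    rw [← Set.ncard_coe_finset L, ← Set.ncard_image_of_injective _ Subtype.val_injective]
    apply Set.ncard_le_ncard _ (Finset.finite_toSet L)
    rintro _ ⟨v, hv, rfl⟩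
    apply h5
    rw [← hv]
    exact (Nat.card_congr (Subgraph.coeNeighborSetEquiv v)).symm

open Classical in
lemma ET.path {V : Type*} [Finite V] {G : SimpleGraph V} {c a : V} {l : List V}
    (hc : (c :: a :: l).IsChain G.Adj) (hn : (c :: a :: l).Nodup) :
    ∃ t, ET G {u | u ∈ c :: a :: l} {t, c} := by
  rw [List.isChain_cons_cons] at hc
  have := ET.edge hc.1
  rw [Finset.pair_comm] at this
  obtain ⟨t, ht⟩ := ET.ext l this (by simp) hc.2 (by grind) (by simp; grind)
  refine ⟨t, ?_⟩
  convert ht using 1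
  ext x; simp; tauto

open Classical in
lemma ET.spider {V : Type*} [Finite V] {G : SimpleGraph V} {c : V} {A B C : List V}
    (hA : (c :: A).IsChain G.Adj) (hB : (c :: B).IsChain G.Adj) (hC : (c :: C).IsChain G.Adj)
    (hn : (c :: (A ++ B ++ C)).Nodup) (nA : A ≠ []) (nB : B ≠ []) (nC : C ≠ []) :
    ∃ L : Finset V, L.card ≤ 3 ∧ ET G {u | u ∈ c :: (A ++ B ++ C)} L := by
  obtain ⟨a, A, rfl⟩ := List.exists_cons_of_ne_nil nA
  obtain ⟨b, B, rfl⟩ := List.exists_cons_of_ne_nil nB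
  obtain ⟨d, C, rfl⟩ := List.exists_cons_of_ne_nil nC
  simp only [List.nodup_cons, List.nodup_append, List.mem_append, List.mem_cons] at hn
  obtain ⟨t, h1⟩ := ET.path hA (by simp; grind)
  rw [List.isChain_cons_cons] at hB hC
  have h2 := h1.attach (v := c) (w := b) (by simp) (by simp; grind) hB.1
  have h3 : ET G _ (insert b {t}) := h2.mono (by intro x; simp; tauto)
  obtain ⟨s, h4⟩ := ET.ext B h3 (by simp) hB.2 (by grind) (by simp; grind)
  have h5 := h4.attach (v := c) (w := d) (by simp) (by simp; grind) hC.1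
  have h6 : ET G _ (insert d {s, t}) := h5.mono (by intro x; simp; tauto)
  obtain ⟨r, h7⟩ := ET.ext C h6 (by simp) hC.2 (by grind) (by simp; grind)
  refine ⟨{r, s, t}, Finset.card_le_three, ?_⟩
  convert h7 using 1
  ext x; simp; tauto

lemma exists_pendant_edge {V : Type*} {G : SimpleGraph V} (hconn : G.Connected) {S : Set V}
    (hS : S.Nonempty) (hd : ¬ IsIndep G Sᶜ) :
    ∃ s ∈ S, ∃ u v, u ∉ S ∧ v ∉ S ∧ G.Adj s u ∧ G.Adj u v := by
  simp only [IsIndep, Set.Pairwise] at hd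
  push Not at hd
  obtain ⟨a, ha, b, hb, -, hab⟩ := hd
  obtain ⟨s, hs⟩ := hS
  obtain ⟨p⟩ := hconn.preconnected a s
  induction p generalizing b with
  | nil => exact absurd hs ha
  | @cons x y z h p ih =>
    by_cases hy : y ∈ S
    · exact ⟨y, hy, x, b, ha, hb, h.symm, hab⟩
    · exact ih hy x ha h.symm hs

def Seg {V : Type*} (G : SimpleGraph V) (l : List V) (a b : V) : Prop :=
  l.IsChain G.Adj ∧ l.head? = some a ∧ l.getLast? = some b

lemma Seg.app {V : Type*} {G : SimpleGraph V} {l l' : List V} {a b b' d : V}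
    (h : Seg G l a b) (h' : Seg G l' b' d) (hb : G.Adj b b') : Seg G (l ++ l') a d := by
  obtain ⟨h1, h2, h3⟩ := h
  obtain ⟨h1', h2', h3'⟩ := h'
  refine ⟨?_, ?_, ?_⟩
  · rw [List.isChain_append]
    refine ⟨h1, h1', ?_⟩
    rw [h3, h2']
    rintro x ⟨⟩ y ⟨⟩
    exact hb
  · simp [List.head?_append, h2]
  · simp [List.getLast?_append, h3']

lemma Seg.rev {V : Type*} {G : SimpleGraph V} {l : List V} {a b : V}
    (h : Seg G l a b) : Seg G l.reverse b a := by
  obtain ⟨h1, h2, h3⟩ := h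
  refine ⟨?_, by simpa using h3, by simpa using h2⟩
  rw [List.isChain_reverse]
  exact h1.imp fun _ _ h => h.symm

lemma Seg.single {V : Type*} {G : SimpleGraph V} {a : V} : Seg G [a] a a :=
  ⟨by simp, rfl, rfl⟩

lemma Seg.take {V : Type*} {G : SimpleGraph V} {l : List V} {a b t : V} {i : ℕ}
    (h : Seg G l a b) (ht : l[i]? = some t) : Seg G (l.take (i+1)) a t := by
  obtain ⟨h1, h2, h3⟩ := h
  refine ⟨h1.take _, by simpa [List.head?_take] using h2, ?_⟩
  simp [List.getLast?_take, ht]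

lemma Seg.drop {V : Type*} {G : SimpleGraph V} {l : List V} {a b t : V} {i : ℕ}
    (h : Seg G l a b) (ht : l[i]? = some t) : Seg G (l.drop i) t b := by
  obtain ⟨h1, h2, h3⟩ := h
  obtain ⟨hi, -⟩ := List.getElem?_eq_some_iff.1 ht
  refine ⟨h1.drop _, by simpa [List.head?_drop] using ht, ?_⟩
  rw [List.getLast?_drop, if_neg (by omega), h3]

section
variable {V : Type*} {G : SimpleGraph V} {N : ℕ}
  {c x y z u w p q : V} {P Q B C : List V}

lemma cross1 (hM : ∀ p : List V, p.IsChain G.Adj → p.Nodup → p.length + 2 ≤ N)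
    (hP : Seg G P c p) (hQ : Seg G Q q x) (hB : Seg G B u y) (hC : Seg G C w z)
    (hcw : G.Adj c w) (hn : (P ++ Q ++ B ++ C).Nodup)
    (hl : N ≤ P.length + Q.length + B.length + C.length + 1)
    (h1 : G.Adj x p) (h2 : G.Adj y q) : False := by
  have := ((hC.rev.app hP hcw.symm).app hQ.rev h1.symm).app hB.rev h2.symm
  have := hM _ this.1 (by
    simp only [List.nodup_append, List.nodup_reverse, List.mem_append, List.mem_reverse] at hn ⊢
    grind)
  simp at this
  omega

lemma cross2 (hM : ∀ p : List V, p.IsChain G.Adj → p.Nodup → p.length + 2 ≤ N)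
    (hP : Seg G P c p) (hQ : Seg G Q q x) (hB : Seg G B u y) (hC : Seg G C w z)
    (hcw : G.Adj c w) (hn : (P ++ Q ++ B ++ C).Nodup)
    (hl : N ≤ P.length + Q.length + B.length + C.length + 1)
    (h1 : G.Adj y p) (h2 : G.Adj z q) : False := by
  have := ((hB.app hP.rev h1).app hC hcw).app hQ h2
  have := hM _ this.1 (by
    simp only [List.nodup_append, List.nodup_reverse, List.mem_append, List.mem_reverse] at hn ⊢
    grind)
  simp at this
  omega

lemma cross5 (hM : ∀ p : List V, p.IsChain G.Adj → p.Nodup → p.length + 2 ≤ N)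
    (hQ : Seg G Q q x) (hB : Seg G B u y) (hC : Seg G C w z)
    (hcu : G.Adj c u) (hcw : G.Adj c w) (hn : ([c] ++ Q ++ B ++ C).Nodup)
    (hl : N ≤ 1 + Q.length + B.length + C.length + 1)
    (h2 : G.Adj z q) : False := by
  have := ((hB.rev.app Seg.single hcu.symm).app hC hcw).app hQ h2
  have := hM _ this.1 (by
    simp only [List.nodup_append, List.nodup_reverse, List.mem_append, List.mem_reverse] at hn ⊢
    grind)
  simp at this
  omega

end

open Classical in
noncomputable def cnt {V : Type*} (G : SimpleGraph V) (x : V) (l : List V) : ℕ :=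
  (l.toFinset.filter (fun v => G.Adj x v)).card

open Classical in
lemma cnt_le {V : Type*} {G : SimpleGraph V} {x : V} {l : List V} (f : ℕ → V) (s : Finset ℕ)
    (h : ∀ v ∈ l, G.Adj x v → ∃ i ∈ s, f i = v) : cnt G x l ≤ s.card := by
  refine le_trans (Finset.card_le_card ?_) (Finset.card_image_le (s := s) (f := f))
  intro v hv
  simp only [Finset.mem_filter, List.mem_toFinset] at hv
  simpa using h v hv.1 hv.2

open Classical in
lemma leg_count {V : Type*} {G : SimpleGraph V} {N : ℕ} {c x y z u w a : V} {A B C : List V}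
    (hM : ∀ p : List V, p.IsChain G.Adj → p.Nodup → p.length + 2 ≤ N)
    (hA : Seg G A a x) (hB : Seg G B u y) (hC : Seg G C w z)
    (hca : G.Adj c a) (hcu : G.Adj c u) (hcw : G.Adj c w)
    (hn : (c :: (A ++ B ++ C)).Nodup)
    (hl : N = A.length + B.length + C.length + 1) :
    ¬ G.Adj x y ∧ cnt G x (c :: A) + cnt G y A + cnt G z A ≤ A.length := by
  have hS : Seg G (c :: A) c x := Seg.single.app hA hca
  set v : ℕ → V := fun i => (c :: A).getD i c with hv
  have hvi : ∀ i, i ≤ A.length → (c :: A)[i]? = some (v i) := by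
    intro i hi
    simp only [hv, List.getD_eq_getElem?_getD]
    rw [List.getElem?_eq_getElem (by simp; omega)]; rfl
  have hva : v A.length = x := by
    have := hvi _ le_rfl
    have h2 := hS.2.2
    rw [List.getLast?_eq_getElem?] at h2
    simp only [List.length_cons, Nat.add_sub_cancel] at h2
    rw [h2] at this
    exact (Option.some.inj this).symm
  have hv0 : v 0 = c := rfl
  have hmem : ∀ t ∈ c :: A, ∃ i ≤ A.length, v i = t := by
    intro t ht
    obtain ⟨i, hi⟩ := List.getElem?_of_mem ht
    obtain ⟨hi', -⟩ := List.getElem?_eq_some_iff.1 hi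
    simp at hi'
    refine ⟨i, by omega, ?_⟩
    rw [hvi i (by omega)] at hi
    exact Option.some.inj hi
  have hmem' : ∀ t ∈ A, ∃ i ≤ A.length, 1 ≤ i ∧ v i = t := by
    intro t ht
    obtain ⟨i, hi, h⟩ := hmem t (by simp [ht])
    refine ⟨i, hi, ?_, h⟩
    rcases Nat.eq_zero_or_pos i with rfl | h0
    · exfalso
      rw [hv0] at h
      subst h
      simp at hn
      exact hn.1.1 ht
    · exact h0
  have hn0 : ((c :: A) ++ B ++ C).Nodup := by simpa using hn
  have hn1 : ∀ i, ((c :: A).take i ++ (c :: A).drop i ++ B ++ C).Nodup := by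
    intro i; rw [List.take_append_drop]; exact hn0
  have hn2 : ∀ i, ((c :: A).take i ++ (c :: A).drop (i+1) ++ B ++ C).Nodup := by
    intro i
    refine (hn1 i).sublist ?_
    refine List.Sublist.append (List.Sublist.append (List.Sublist.append (List.Sublist.refl _) ?_) (List.Sublist.refl _)) (List.Sublist.refl _)
    rw [← List.drop_drop]
    exact List.drop_sublist _ _
  have k1 : ∀ i, i < A.length → G.Adj x (v i) → ¬ G.Adj y (v (i+1)) := by
    intro i hi h1 h2
    refine cross1 hM (hS.take (hvi i (by omega))) (hS.drop (hvi (i+1) (by omega))) hB hC hcw (hn1 _) ?_ h1 h2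
    simp; omega
  have k2 : ∀ i, i < A.length → G.Adj y (v i) → ¬ G.Adj z (v (i+1)) := by
    intro i hi h1 h2
    refine cross2 hM (hS.take (hvi i (by omega))) (hS.drop (hvi (i+1) (by omega))) hB hC hcw (hn1 _) ?_ h1 h2
    simp; omega
  have k3 : ∀ i, i + 2 ≤ A.length → G.Adj x (v i) → ¬ G.Adj z (v (i+2)) := by
    intro i hi h1 h2
    refine cross1 hM (hS.take (hvi i (by omega))) (hS.drop (hvi (i+2) (by omega))) hC hB hcu ?_ ?_ h1 h2
    · have := hn2 (i+1)
      rw [List.append_assoc] at this ⊢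
      exact ((List.perm_append_comm (l₁ := C) (l₂ := B)).append_left _).nodup_iff.2 this
    simp; omega
  have hApos : 1 ≤ A.length := by
    rcases A with _ | _
    · simp [Seg] at hA
    · simp
  have k5 : ¬ G.Adj z (v 1) := by
    intro h2
    refine cross5 hM (hS.drop (hvi 1 (by omega))) hB hC hcu hcw (by simpa using hn0) ?_ h2
    simp; omega
  refine ⟨?_, ?_⟩
  · intro h
    have h0 : G.Adj (v (A.length - 1)) (v A.length) := by
      have := List.isChain_iff_getElem.1 hS.1 (A.length - 1) (by simp; omega)
      have e1 := hvi (A.length - 1) (by omega)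
      have e2 := hvi (A.length) (by omega)
      obtain ⟨_, e1⟩ := List.getElem?_eq_some_iff.1 e1
      obtain ⟨_, e2⟩ := List.getElem?_eq_some_iff.1 e2
      rw [← e1, ← e2]
      convert this using 2
      omega
    rw [hva] at h0
    refine k1 (A.length - 1) (by omega) h0.symm ?_
    rw [Nat.sub_add_cancel hApos, hva]
    exact h.symm
  · have c1 : cnt G x (c :: A) ≤ ((Finset.range A.length).filter (fun i => G.Adj x (v i))).card := by
      apply cnt_le v
      intro t ht hxt
      obtain ⟨i, hi, rfl⟩ := hmem t ht
      refine ⟨i, ?_, rfl⟩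
      have : i ≠ A.length := by
        rintro rfl
        rw [hva] at hxt
        exact G.irrefl hxt
      simp [hxt]; omega
    have c2 : cnt G y A ≤ ((Finset.range A.length).filter (fun i => G.Adj y (v (i+1)))).card := by
      apply cnt_le (fun i => v (i+1))
      intro t ht hxt
      obtain ⟨i, hi, hi1, rfl⟩ := hmem' t ht
      obtain ⟨j, rfl⟩ : ∃ j, i = j + 1 := ⟨i-1, by omega⟩
      refine ⟨j, ?_, rfl⟩
      simp [hxt]; omega
    have c3 : cnt G z A ≤ ((Finset.range A.length).filter (fun i => i + 2 ≤ A.length ∧ G.Adj z (v (i+2)))).card := by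
      apply cnt_le (fun i => v (i+2))
      intro t ht hxt
      obtain ⟨i, hi, hi1, rfl⟩ := hmem' t ht
      have : i ≠ 1 := by rintro rfl; exact k5 hxt
      obtain ⟨j, rfl⟩ : ∃ j, i = j + 2 := ⟨i-2, by omega⟩
      refine ⟨j, ?_, rfl⟩
      simp [hxt]; omega
    have : ((Finset.range A.length).filter (fun i => G.Adj x (v i))).card
        + ((Finset.range A.length).filter (fun i => G.Adj y (v (i+1)))).card
        + ((Finset.range A.length).filter (fun i => i + 2 ≤ A.length ∧ G.Adj z (v (i+2)))).card
        ≤ A.length := by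
      rw [← Finset.card_union_of_disjoint, ← Finset.card_union_of_disjoint]
      · refine (Finset.card_le_card (t := Finset.range A.length) ?_).trans (by simp)
        intro i; simp; tauto
      · rw [Finset.disjoint_left]
        intro i
        simp only [Finset.mem_union, Finset.mem_filter, Finset.mem_range]
        rintro (⟨h1, h2⟩ | ⟨h1, h2⟩) ⟨h3, h4, h5⟩
        · exact k3 i h4 h2 h5
        · exact k2 (i+1) (by omega) h2 h5
      · rw [Finset.disjoint_left]
        intro i
        simp only [Finset.mem_filter, Finset.mem_range]
        rintro ⟨h1, h2⟩ ⟨h3, h4⟩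
        exact k1 i h1 h2 h4
    omega

lemma chain_join {V : Type*} {G : SimpleGraph V} {c : V} {A B : List V}
    (hA : (c :: A).IsChain G.Adj) (hB : (c :: B).IsChain G.Adj) :
    (A.reverse ++ c :: B).IsChain G.Adj := by
  rw [List.isChain_split]
  refine ⟨?_, hB⟩
  rw [← List.reverse_cons, List.isChain_reverse]
  exact hA.imp fun _ _ h => h.symm

lemma exists_seg {V : Type*} {G : SimpleGraph V} {c : V} {A : List V}
    (hA : (c :: A).IsChain G.Adj) (h : A ≠ []) : ∃ a x, Seg G A a x ∧ G.Adj c a := by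
  obtain ⟨a, A, rfl⟩ := List.exists_cons_of_ne_nil h
  rw [List.isChain_cons_cons] at hA
  exact ⟨a, (a :: A).getLast h, ⟨hA.2, rfl, List.getLast?_eq_some_getLast h⟩, hA.1⟩

lemma chain_snoc {V : Type*} {G : SimpleGraph V} {c a x t : V} {A : List V}
    (hA : Seg G A a x) (hc : G.Adj c a) (ht : G.Adj x t) : (c :: (A ++ [t])).IsChain G.Adj :=
  ((Seg.single.app hA hc).app Seg.single ht).1

open Classical in
lemma deg_le {V : Type*} [Fintype V] {G : SimpleGraph V} {x c : V} {A B C : List V}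
    (h : ∀ t, G.Adj x t → t ∈ c :: (A ++ B ++ C)) :
    deg G x ≤ cnt G x (c :: A) + cnt G x B + cnt G x C := by
  unfold deg cnt
  refine le_trans ?_ ((Finset.card_union_le _ _).trans (Nat.add_le_add_right (Finset.card_union_le _ _) _))
  rw [← Set.ncard_coe_finset]
  apply Set.ncard_le_ncard _ (Finset.finite_toSet _)
  intro t ht
  have h1 : G.Adj x t := ht
  have := h t h1
  simp at this ⊢
  tauto

lemma singleton_ended {V : Type*} [Finite V] (G : SimpleGraph V) (c : V) :
    IsEndedTree (G.singletonSubgraph c) 2 := by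
  refine ⟨IsTree.coe_singletonSubgraph G c, ?_⟩
  unfold leafCount
  rw [← Set.ncard_image_of_injective _ Subtype.val_injective]
  refine (Set.ncard_le_ncard (t := {c}) ?_ (by simp)).trans (by simp)
  rintro _ ⟨⟨v, hv⟩, -, rfl⟩
  simpa using hv

lemma base_case {V : Type*} [Fintype V] (G : SimpleGraph V) (hconn : G.Connected)
    (hno : ¬ ∃ H : G.Subgraph, IsEndedTree H 2 ∧ IsIndep G H.vertsᶜ) :
    ∃ (S : Set V) (L : Finset V), ET G S L ∧ L.card ≤ 3 ∧ sigma3 G + 1 ≤ S.ncard := by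
  classical
  have nd : ∀ p : List V, p.IsChain G.Adj → p.Nodup → p ≠ [] → ¬ IsIndep G {u | u ∈ p}ᶜ := by
    intro p hp hn hne hi
    apply hno
    match p, hne with
    | [c], _ => exact ⟨_, singleton_ended G c, by simpa [Set.ofPred_eq_eq_singleton] using hi⟩
    | c :: a :: l, _ =>
      obtain ⟨t, ht⟩ := ET.path hp hn
      obtain ⟨H, h1, h2⟩ := ht.ended (Finset.card_le_two)
      exact ⟨H, h1, by rw [h2]; exact hi⟩
  let Pm : ℕ → Prop := fun N => ∃ c A B C, (c :: A).IsChain G.Adj ∧ (c :: B).IsChain G.Adj ∧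
    (c :: C).IsChain G.Adj ∧ (c :: (A ++ B ++ C)).Nodup ∧ N = A.length + B.length + C.length + 1
  have hbd : ∀ N, Pm N → N ≤ Fintype.card V := by
    rintro N ⟨c, A, B, C, -, -, -, hn, rfl⟩
    have := hn.length_le_card
    simp at this
    omega
  obtain ⟨c0⟩ := hconn.nonempty
  have hP1 : Pm 1 := ⟨c0, [], [], [], by simp⟩
  obtain ⟨N, hN, hmax⟩ : ∃ N, Pm N ∧ ∀ M, Pm M → M ≤ N := by
    refine ⟨Nat.findGreatest Pm (Fintype.card V), Nat.findGreatest_spec (hbd _ hP1) hP1, ?_⟩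
    intro M hM
    exact Nat.le_findGreatest (hbd _ hM) hM
  have hM1 : ∀ p : List V, p.IsChain G.Adj → p.Nodup → p ≠ [] → p.length + 2 ≤ N := by
    intro p hp hn hne
    obtain ⟨s, hs, u, v, hu, hv, hsu, huv⟩ := exists_pendant_edge hconn
      (S := {u | u ∈ p}) (List.exists_mem_of_ne_nil p hne) (nd p hp hn hne)
    simp only [Set.mem_ofPred_eq] at hs hu hv
    obtain ⟨l1, l2, rfl⟩ := List.append_of_mem hs
    apply hmax
    rw [List.isChain_split] at hp
    refine ⟨s, l1.reverse, l2, [u, v], ?_, hp.2, by simp [hsu, huv], ?_, by simp; omega⟩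
    · have := hp.1
      rw [← List.reverse_reverse l1, ← List.reverse_cons, List.isChain_reverse] at this
      exact this.imp fun _ _ h => h.symm
    · have := huv.ne
      simp only [List.nodup_append, List.nodup_cons, List.mem_append, List.mem_cons, List.nodup_reverse, List.mem_reverse] at hn hu hv ⊢
      grind
  have hM : ∀ p : List V, p.IsChain G.Adj → p.Nodup → p.length + 2 ≤ N := by
    intro p hp hn
    rcases eq_or_ne p [] with rfl | h
    · have := hM1 [c0] (by simp) (by simp) (by simp)
      simp at this ⊢; omega
    · exact hM1 p hp hn h
  obtain ⟨c, A, B, C, hA, hB, hC, hn, hl⟩ := hN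
  have hn' := hn
  simp only [List.nodup_append, List.nodup_cons, List.mem_append] at hn'
  have nA : A ≠ [] := by
    rintro rfl
    have := hM _ (chain_join hB hC) (by
      simp only [List.nodup_append, List.nodup_cons, List.mem_append, List.mem_cons, List.nodup_reverse, List.mem_reverse]
      grind)
    simp at this hl; omega
  have nB : B ≠ [] := by
    rintro rfl
    have := hM _ (chain_join hA hC) (by
      simp only [List.nodup_append, List.nodup_cons, List.mem_append, List.mem_cons, List.nodup_reverse, List.mem_reverse]
      grind)
    simp at this hl; omega
  have nC : C ≠ [] := by
    rintro rfl
    have := hM _ (chain_join hA hB) (by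
      simp only [List.nodup_append, List.nodup_cons, List.mem_append, List.mem_cons, List.nodup_reverse, List.mem_reverse]
      grind)
    simp at this hl; omega
  obtain ⟨a, x, sA, ca⟩ := exists_seg hA nA
  obtain ⟨b, y, sB, cb⟩ := exists_seg hB nB
  obtain ⟨d, z, sC, cd⟩ := exists_seg hC nC
  have pBCA : (c :: (B ++ C ++ A)).Perm (c :: (A ++ B ++ C)) := by
    rw [List.append_assoc A]
    exact (List.perm_append_comm).cons _
  have pCAB : (c :: (C ++ A ++ B)).Perm (c :: (A ++ B ++ C)) := by
    rw [List.append_assoc C]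
    exact (List.perm_append_comm).cons _
  obtain ⟨nxy, l1⟩ := leg_count hM sA sB sC ca cb cd hn hl
  obtain ⟨nyz, l2⟩ := leg_count hM sB sC sA cb cd ca (pBCA.nodup_iff.2 hn) (by omega)
  obtain ⟨nzx, l3⟩ := leg_count hM sC sA sB cd ca cb (pCAB.nodup_iff.2 hn) (by omega)
  have key : ∀ {A B C : List V} {a x : V}, Seg G A a x → G.Adj c a → (c :: B).IsChain G.Adj →
      (c :: C).IsChain G.Adj → (c :: (A ++ B ++ C)).Nodup → N = A.length + B.length + C.length + 1 →
      deg G x ≤ cnt G x (c :: A) + cnt G x B + cnt G x C := by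
    intro A B C a x sA ca hB hC hn hl
    apply deg_le
    intro t ht
    by_contra hcon
    have := hmax (N + 1) ⟨c, A ++ [t], B, C, chain_snoc sA ca ht, hB, hC, by
      have : (c :: (A ++ [t] ++ B ++ C)).Perm (t :: (c :: (A ++ B ++ C))) := by
        refine List.Perm.trans ?_ (List.Perm.swap t c _)
        refine List.Perm.cons _ ?_
        simpa using List.perm_middle (a := t) (l₁ := A) (l₂ := B ++ C)
      exact this.nodup_iff.2 (List.nodup_cons.2 ⟨hcon, hn⟩), by simp; omega⟩
    omega
  have d1 := key sA ca hB hC hn hl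
  have d2 := key sB cb hC hA (pBCA.nodup_iff.2 hn) (by omega)
  have d3 := key sC cd hA hB (pCAB.nodup_iff.2 hn) (by omega)
  have mx : x ∈ A := List.mem_of_getLast? sA.2.2
  have my : y ∈ B := List.mem_of_getLast? sB.2.2
  have mz : z ∈ C := List.mem_of_getLast? sC.2.2
  have hs : sigma3 G ≤ deg G x + deg G y + deg G z := by
    apply Nat.sInf_le
    refine ⟨x, y, z, ?_, ?_, ?_, nxy, fun h => nzx h.symm, nyz, rfl⟩ <;> grind
  obtain ⟨L, hL, hT⟩ := ET.spider hA hB hC hn nA nB nC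
  refine ⟨_, L, hT, hL, ?_⟩
  have : ({u | u ∈ c :: (A ++ B ++ C)} : Set V) = ((c :: (A ++ B ++ C)).toFinset : Set V) := by
    ext; simp
  rw [this, Set.ncard_coe_finset, List.toFinset_card_of_nodup hn]
  have hc : (c :: (A ++ B ++ C)).length = N := by simp; omega
  rw [hc]
  omega

lemma all_cases {V : Type*} [Fintype V] (G : SimpleGraph V) (hconn : G.Connected) (k : ℕ) (hk : 2 ≤ k) :
    (¬ ∃ H : G.Subgraph, IsEndedTree H k ∧ IsIndep G H.vertsᶜ) →
    ∃ (S : Set V) (L : Finset V), ET G S L ∧ L.card ≤ k + 1 ∧ sigma3 G + 2 * k - 3 ≤ S.ncard := by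
  classical
  induction k, hk using Nat.le_induction with
  | base =>
    intro h
    obtain ⟨S, L, h1, h2, h3⟩ := base_case G hconn h
    exact ⟨S, L, h1, h2, by omega⟩
  | succ k hk ih =>
    intro hno
    obtain ⟨S, L, h1, h2, h3⟩ := ih (by
      rintro ⟨H, hH, hi⟩
      exact hno ⟨H, ⟨hH.1, hH.2.trans (by omega)⟩, hi⟩)
    have hd : ¬ IsIndep G Sᶜ := by
      intro hi
      obtain ⟨H, hH, rfl⟩ := h1.ended h2
      exact hno ⟨H, hH, hi⟩
    obtain ⟨s, hs, u, v, hu, hv, hsu, huv⟩ := exists_pendant_edge hconn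
      (S := S) (Set.nonempty_of_ncard_ne_zero (by omega)) hd
    have e1 := h1.attach hs hu hsu
    have hv' : v ∉ insert u S := by
      simp only [Set.mem_insert_iff, not_or]
      exact ⟨huv.ne.symm, hv⟩
    have e2 := e1.attach (v := u) (w := v) (by simp) hv' huv
    refine ⟨_, insert v L, e2.mono ?_, (Finset.card_insert_le _ _).trans (by omega), ?_⟩
    · intro t; simp; tauto
    · rw [Set.ncard_insert_of_notMem hv', Set.ncard_insert_of_notMem hu]
      omega

/-- If `k ≥ 2`, the connected graph `G` contains an independent triple
and has no dominating tree with at most `k` leaves, then `t_{k+1} ≥ σ₃ + 2k - 3`. -/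
theorem treeOrd_succ_ge_of_no_dominating_tree {V : Type*} [Fintype V] (k : ℕ) (hk : 2 ≤ k)
    (G : SimpleGraph V) (hconn : G.Connected)
    (htriple : ∃ x y z : V, x ≠ y ∧ x ≠ z ∧ y ≠ z ∧
      ¬G.Adj x y ∧ ¬G.Adj x z ∧ ¬G.Adj y z)
    (hno : ¬ ∃ H : G.Subgraph, IsEndedTree H k ∧ IsIndep G H.vertsᶜ) :
    sigma3 G + 2 * k - 3 ≤ treeOrd G (k + 1) := by
  obtain ⟨S, L, h1, h2, h3⟩ := all_cases G hconn k hk hno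
  obtain ⟨H, hH, rfl⟩ := h1.ended h2
  refine h3.trans (le_csSup ⟨Nat.card V, ?_⟩ ⟨H, hH, rfl⟩)
  rintro m ⟨H', -, rfl⟩
  exact Set.ncard_le_card _
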